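/- Let K be a field of arbitrary characteristic, let Φ be a group admitting an injective homomorphism ρ : Φ → GL_m(K), let G be a subgroup of GL_n(K), and let θ : Φ → Aut(G) be an action of Φ on G by automorphisms. Suppose that for every φ ∈ Φ there exists g_φ ∈ GL_n(K) such that θ(φ)(g) = g_φ⁻¹ g g_φ for all g ∈ G. Then the semidirect product G ⋊_θ Φ admits an injective group homomorphism into GL_{m² + n⁴}(K). -/

import Mathlib

open scoped MatrixGroups

/-- A faithful representation on a space of dimension at most `N` gives an embedding
into `GL_N(K)`. -/
theorem exists_injective_hom_GL_of_finrank_le {K H V : Type*} [Field K] [Group H]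
    [AddCommGroup V] [Module K V] [FiniteDimensional K V] {N : ℕ}
    (hN : Module.finrank K V ≤ N) (σ : H →* Module.End K V) (hσ : Function.Injective σ) :
    ∃ τ : H →* GL (Fin N) K, Function.Injective τ := by
  have hdim : Module.finrank K (V × (Fin (N - Module.finrank K V) → K)) = N := by
    rw [Module.finrank_prod, Module.finrank_fin_fun]
    lia
  let e := LinearMap.toMatrixAlgEquiv (Module.finBasisOfFinrankEq K _ hdim)
  let π : H →* Module.End K (V × (Fin (N - Module.finrank K V) → K)) :=
    { toFun h := (σ h).prodMap LinearMap.id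
      map_one' := by ext <;> simp
      map_mul' a b := by ext <;> simp }
  refine ⟨((e : _ →* Matrix (Fin N) (Fin N) K).comp π).toHomUnits, fun a b hab ↦ hσ ?_⟩
  have hπ : π a = π b := e.injective (congrArg Units.val hab)
  ext v
  exact congrArg Prod.fst (LinearMap.congr_fun hπ (v, 0))

/-- The linear span of a matrix group. -/
def Subgroup.matrixSpan {K : Type*} [Field K] {n : ℕ} (G : Subgroup (GL (Fin n) K)) :
    Submodule K (Matrix (Fin n) (Fin n) K) :=
  Submodule.span K (Set.range fun g : G ↦ ((g : GL (Fin n) K) : Matrix (Fin n) (Fin n) K))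

theorem Subgroup.coe_mem_matrixSpan {K : Type*} [Field K] {n : ℕ}
    (G : Subgroup (GL (Fin n) K)) (g : G) :
    ((g : GL (Fin n) K) : Matrix (Fin n) (Fin n) K) ∈ G.matrixSpan :=
  Submodule.subset_span ⟨g, rfl⟩

/-- If every `θ φ` is induced by a conjugation, then `G ⋊[θ] Φ` acts linearly on the span of `G`,
extending the left translations of `G` and the action `θ`. -/
theorem exists_representation_matrixSpan {K : Type*} [Field K] {n : ℕ} {Φ : Type*} [Group Φ]
    (G : Subgroup (GL (Fin n) K)) (θ : Φ →* MulAut G)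
    (hθ : ∀ φ : Φ, ∃ gφ : GL (Fin n) K, ∀ g : G,
      ((θ φ g : G) : GL (Fin n) K) = gφ⁻¹ * (g : GL (Fin n) K) * gφ) :
    ∃ σ : (G ⋊[θ] Φ) →* Module.End K G.matrixSpan, ∀ (x : G ⋊[θ] Φ) (g : G),
      (σ x ⟨_, G.coe_mem_matrixSpan g⟩ : Matrix (Fin n) (Fin n) K) =
        ((x.left * θ x.right g : G) : GL (Fin n) K) := by
  choose c hc using hθ
  let T (x : G ⋊[θ] Φ) : Module.End K (Matrix (Fin n) (Fin n) K) :=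
    LinearMap.mulLeft K (((x.left : GL (Fin n) K) * (c x.right)⁻¹ : GL (Fin n) K) :
      Matrix (Fin n) (Fin n) K) ∘ₗ
      LinearMap.mulRight K ((c x.right : GL (Fin n) K) : Matrix (Fin n) (Fin n) K)
  have hT (x : G ⋊[θ] Φ) (g : G) : T x ((g : GL (Fin n) K) : Matrix (Fin n) (Fin n) K) =
      ((x.left * θ x.right g : G) : GL (Fin n) K) := by
    rw [Subgroup.coe_mul, hc]
    simp only [T, LinearMap.comp_apply, LinearMap.mulLeft_apply, LinearMap.mulRight_apply,
      ← Units.val_mul, mul_assoc]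
  have hmem (x : G ⋊[θ] Φ) : ∀ v ∈ G.matrixSpan, T x v ∈ G.matrixSpan := by
    refine Submodule.span_le (p := G.matrixSpan.comap (T x)).2 ?_
    rintro _ ⟨g, rfl⟩
    change T x _ ∈ G.matrixSpan
    rw [hT]
    exact G.coe_mem_matrixSpan _
  have hone : Set.EqOn (T 1) (1 : Module.End K (Matrix (Fin n) (Fin n) K))
      (G.matrixSpan : Set (Matrix (Fin n) (Fin n) K)) := by
    refine LinearMap.eqOn_span ?_
    rintro _ ⟨g, rfl⟩
    simp [hT]
  have hmul (x y : G ⋊[θ] Φ) : Set.EqOn (T (x * y)) (T x ∘ₗ T y)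
      (G.matrixSpan : Set (Matrix (Fin n) (Fin n) K)) := by
    refine LinearMap.eqOn_span ?_
    rintro _ ⟨g, rfl⟩
    simp only [LinearMap.comp_apply, hT, SemidirectProduct.mul_left, SemidirectProduct.mul_right,
      map_mul, MulAut.mul_apply, mul_assoc]
  exact ⟨{ toFun x := (T x).restrict (hmem x)
           map_one' := LinearMap.ext fun v ↦ Subtype.ext (hone v.2)
           map_mul' x y := LinearMap.ext fun v ↦ Subtype.ext (hmul x y v.2) }, hT⟩

/-- **Theorem 1.** Let `K` be a field of arbitrary characteristic, `Φ` a group linear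
over `K` via `ρ : Φ → GL_m(K)`, and `G ≤ GL_n(K)`.  If for every `φ ∈ Φ` there is
`g_φ ∈ GL_n(K)` with `θ(φ)(g) = g_φ⁻¹ g g_φ` for all `g ∈ G`, then the semidirect
product `G ⋊ Φ` embeds into `GL_{m² + n⁴}(K)`. -/
theorem semidirect_linear {K : Type*} [Field K] (m n : ℕ) {Φ : Type*} [Group Φ]
    (ρ : Φ →* GL (Fin m) K) (hρ : Function.Injective ρ)
    (G : Subgroup (GL (Fin n) K)) (θ : Φ →* MulAut G)
    (hθ : ∀ φ : Φ, ∃ gφ : GL (Fin n) K, ∀ g : G,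
      ((θ φ g : G) : GL (Fin n) K) = gφ⁻¹ * (g : GL (Fin n) K) * gφ) :
    ∃ ρ' : (G ⋊[θ] Φ) →* GL (Fin (m ^ 2 + n ^ 4)) K, Function.Injective ρ' := by
  obtain ⟨σ, hσ⟩ := exists_representation_matrixSpan G θ hθ
  have hdim : Module.finrank K ((Fin m → K) × G.matrixSpan) ≤ m ^ 2 + n ^ 4 := by
    have hspan : Module.finrank K G.matrixSpan ≤ n ^ 2 := by
      simpa [Module.finrank_matrix, sq] using Submodule.finrank_le G.matrixSpan
    rw [Module.finrank_prod, Module.finrank_fin_fun]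
    have hm : m ≤ m ^ 2 := Nat.le_self_pow two_ne_zero m
    have hn : n ^ 2 ≤ (n ^ 2) ^ 2 := Nat.le_self_pow two_ne_zero _
    rw [← pow_mul] at hn
    lia
  let R (x : G ⋊[θ] Φ) : Module.End K (Fin m → K) :=
    Matrix.toLinAlgEquiv' (ρ x.right : Matrix (Fin m) (Fin m) K)
  let π : (G ⋊[θ] Φ) →* Module.End K ((Fin m → K) × G.matrixSpan) :=
    { toFun x := (R x).prodMap (σ x)
      map_one' := by
        have hR : R 1 = 1 := by simp [R]
        rw [hR, map_one]
        rfl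
      map_mul' x y := by
        have hR : R (x * y) = R x * R y := by simp [R]
        rw [hR, map_mul]
        rfl }
  refine exists_injective_hom_GL_of_finrank_le hdim π fun x y hxy ↦ ?_
  have hright : x.right = y.right := by
    refine hρ (Units.ext (Matrix.toLinAlgEquiv'.injective (LinearMap.ext fun v ↦ ?_)))
    exact congrArg Prod.fst (LinearMap.congr_fun hxy (v, 0))
  refine SemidirectProduct.ext ?_ hright
  have h := congrArg (fun z ↦ (z.2 : Matrix (Fin n) (Fin n) K))
    (LinearMap.congr_fun hxy (0, ⟨_, G.coe_mem_matrixSpan 1⟩))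
  have h' : (σ x ⟨_, G.coe_mem_matrixSpan 1⟩ : Matrix (Fin n) (Fin n) K) =
    σ y ⟨_, G.coe_mem_matrixSpan 1⟩ := h
  rw [hσ, hσ, map_one, map_one, mul_one, mul_one] at h'
  exact Subtype.ext (Units.ext h')
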